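/- If C is a Hermitian self-orthogonal F_4-linear code of length n and dimension k (so C ⊆ C^⊥H), then there exists an asymmetric quantum code with parameters ((n, 4^{n−2k}, d'/d'))_4, where d' = d(C^⊥H) is the minimum distance of the Hermitian dual of C. -/

import Mathlib

open scoped Classical

noncomputable section

namespace AQC

/-- Hamming weight of a vector: the number of nonzero entries. -/
def wt {n : ℕ} {α : Type*} [Zero α] (u : Fin n → α) : ℕ :=
  (Finset.univ.filter (fun i => u i ≠ 0)).card

variable (p m n : ℕ) [Fact p.Prime]

instance : Fintype (GaloisField p m) := Fintype.ofFinite _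

/-- Words of length `n` over the field `F_q` with `q = p ^ m`. -/
abbrev Word := Fin n → GaloisField p m

/-- The usual dot product `u · v = ∑ i, u i * v i` on `F_q ^ n`. -/
def dotW (u v : Word p m n) : GaloisField p m := ∑ i, u i * v i

/-- The state space `V_n = ℂ^(F_q^n)`. -/
abbrev QV := Word p m n → ℂ

/-- The trace map `T : F_q → F_p`. -/
def gfTr (x : GaloisField p m) : ZMod p := Algebra.trace (ZMod p) (GaloisField p m) x

/-- `η = exp(2πi/p)`, a primitive `p`-th root of unity. -/
def eta : ℂ := Complex.exp (2 * Real.pi * Complex.I / p)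

/-- The additive character `x ↦ η ^ x` of `F_p`. -/
def chi (x : ZMod p) : ℂ := eta p ^ x.val

/-- The Hermitian inner product `⟨u|v⟩ = ∑ c, conj (u c) * v c` on the state space. -/
def hInner (u v : QV p m n) : ℂ := ∑ c, (starRingEnd ℂ) (u c) * v c

/-- The error operator `e = X(a)Z(b)`, acting by `e|c⟩ = η^{T(b·c)} |a+c⟩`. -/
def errOp (a b : Word p m n) : QV p m n →ₗ[ℂ] QV p m n where
  toFun f := fun x => chi p (gfTr p m (dotW p m n b (x - a))) * f (x - a)
  map_add' f g := by funext x; simp [mul_add]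
  map_smul' c f := by funext x; simp; ring

/-- Purity of an asymmetric quantum code with parameters `((n,K,d_z/d_x))_q`. -/
def IsPureAQEC (Q : Submodule ℂ (QV p m n)) (dz dx : ℕ) : Prop :=
  ∀ u ∈ Q, ∀ v ∈ Q, ∀ a b : Word p m n,
    1 ≤ wt a → wt a ≤ dx - 1 → 1 ≤ wt b → wt b ≤ dz - 1 →
      hInner p m n u (errOp p m n a b v) = 0

/-- `Q` is an asymmetric quantum code with parameters `((n,K,d_z/d_x))_q`:
a `K`-dimensional subspace of `V_n` detecting `d_x - 1` qudits of `X`-errors and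
`d_z - 1` qudits of `Z`-errors; a code with `K = 1` is required to be pure. -/
def IsAQEC (Q : Submodule ℂ (QV p m n)) (K dz dx : ℕ) : Prop :=
  Module.finrank ℂ Q = K ∧ 1 ≤ K ∧
  (∀ u ∈ Q, ∀ v ∈ Q, hInner p m n u v = 0 →
    ∀ a b : Word p m n, wt a ≤ dx - 1 → wt b ≤ dz - 1 →
      hInner p m n u (errOp p m n a b v) = 0) ∧
  (K = 1 → IsPureAQEC p m n Q dz dx)

/-- Minimum distance of a set of words (`0` if the set has no nonzero element). -/
def minDistS {n : ℕ} {α : Type*} [Zero α] (S : Set (Fin n → α)) : ℕ :=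
  sInf {d | ∃ u ∈ S, u ≠ 0 ∧ wt u = d}

/-- Hermitian dual of an `F_4`-linear code. -/
def dualH (n : ℕ) (C : Submodule (GaloisField 2 2) (Word 2 2 n)) :
    Submodule (GaloisField 2 2) (Word 2 2 n) where
  carrier := {u | ∀ v ∈ C, ∑ i, u i * (v i) ^ 2 = 0}
  add_mem' := by
    intro u w hu hw v hv
    have h : ∑ i, (u + w) i * (v i) ^ 2 =
        (∑ i, u i * (v i) ^ 2) + ∑ i, w i * (v i) ^ 2 := by
      simp [← Finset.sum_add_distrib, add_mul]
    rw [h, hu v hv, hw v hv, add_zero]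
  zero_mem' := by intro v hv; simp
  smul_mem' := by
    intro c u hu v hv
    have h : ∑ i, (c • u) i * (v i) ^ 2 = c * ∑ i, u i * (v i) ^ 2 := by
      simp [Finset.mul_sum, mul_assoc]
    rw [h, hu v hv, mul_zero]


lemma gf_pow4 (x : GaloisField 2 2) : (x ^ 2) ^ 2 = x := by
  have h := FiniteField.pow_card x
  rw [← Nat.card_eq_fintype_card, GaloisField.card 2 2 (by norm_num)] at h
  rw [← pow_mul]; simpa using h

lemma gf_add_sq (x y : GaloisField 2 2) : (x + y) ^ 2 = x ^ 2 + y ^ 2 :=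
  add_pow_char x y 2

lemma gf_sum_sq {ι : Type*} (s : Finset ι) (f : ι → GaloisField 2 2) :
    (∑ i ∈ s, f i) ^ 2 = ∑ i ∈ s, f i ^ 2 :=
  sum_pow_char 2 s f

lemma gf_card : Fintype.card (GaloisField 2 2) = 4 := by
  rw [← Nat.card_eq_fintype_card, GaloisField.card 2 2 (by norm_num)]; norm_num

/-- The entrywise conjugate of a code. -/
def conjCode (n : ℕ) (C : Submodule (GaloisField 2 2) (Word 2 2 n)) :
    Submodule (GaloisField 2 2) (Word 2 2 n) where
  carrier := {u | (fun i => u i ^ 2) ∈ C}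
  add_mem' := by
    intro u w hu hw
    have := C.add_mem hu hw
    refine (congrArg (· ∈ C) ?_).mpr this
    funext i
    simp [gf_add_sq]
  zero_mem' := by
    have := C.zero_mem
    refine (congrArg (· ∈ C) ?_).mpr this
    funext i
    simp
  smul_mem' := by
    intro c u hu
    have := C.smul_mem (c ^ 2) hu
    refine (congrArg (· ∈ C) ?_).mpr this
    funext i
    simp [mul_pow]

lemma finrank_conj (n : ℕ) (C : Submodule (GaloisField 2 2) (Word 2 2 n)) :
    Module.finrank (GaloisField 2 2) (conjCode n C) = Module.finrank (GaloisField 2 2) C := by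
  let e : conjCode n C ≃ C :=
    { toFun := fun u => ⟨fun i => u.1 i ^ 2, u.2⟩
      invFun := fun u => ⟨fun i => u.1 i ^ 2, by
        show (fun i => (u.1 i ^ 2) ^ 2) ∈ C
        simp only [gf_pow4]; exact u.2⟩
      left_inv := fun u => by ext i; simp [gf_pow4]
      right_inv := fun u => by ext i; simp [gf_pow4] }
  have h1 := Module.card_eq_pow_finrank (K := GaloisField 2 2) (V := conjCode n C)
  have h2 := Module.card_eq_pow_finrank (K := GaloisField 2 2) (V := C)
  rw [Fintype.card_congr e, h2, gf_card] at h1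
  exact (Nat.pow_right_injective (le_refl 2 |>.trans (by norm_num : 2 ≤ 4)) h1).symm

lemma finrank_dualH (n : ℕ) (C : Submodule (GaloisField 2 2) (Word 2 2 n)) :
    Module.finrank (GaloisField 2 2) (dualH n C)
      = n - Module.finrank (GaloisField 2 2) C := by
  let B : LinearMap.BilinForm (GaloisField 2 2) (Word 2 2 n) :=
    Matrix.toBilin' (1 : Matrix (Fin n) (Fin n) (GaloisField 2 2))
  have hBa : ∀ x y, B x y = ∑ i, x i * y i := by
    intro x y
    simp [B, Matrix.toBilin'_apply', dotProduct]
  have hB : B.Nondegenerate :=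
    LinearMap.BilinForm.nondegenerate_toBilin'_of_det_ne_zero' _ (by simp)
  have h := LinearMap.BilinForm.finrank_orthogonal hB (conjCode n C)
  rw [finrank_conj] at h
  have heq : dualH n C = B.orthogonal (conjCode n C) := by
    ext u
    rw [LinearMap.BilinForm.mem_orthogonal_iff]
    constructor
    · intro hu v hv
      have := hu _ hv
      simp only [gf_pow4] at this
      show B v u = 0
      rw [hBa, ← this]
      exact Finset.sum_congr rfl fun i _ => mul_comm _ _
    · intro hu v hv
      have h1 : (fun i => v i ^ 2) ∈ conjCode n C := by
        show (fun i => (v i ^ 2) ^ 2) ∈ C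
        simp only [gf_pow4]; exact hv
      have : B (fun i => v i ^ 2) u = 0 := hu _ h1
      rw [hBa] at this
      rw [← this]
      exact Finset.sum_congr rfl fun i _ => mul_comm _ _
  rw [heq, h]; simp

/-- Functions supported on `B` and invariant under translations by `A`. -/
def cssCode (n : ℕ) (A B : Submodule (GaloisField 2 2) (Word 2 2 n)) :
    Submodule ℂ (QV 2 2 n) where
  carrier := {f | (∀ x, x ∉ B → f x = 0) ∧ ∀ x, ∀ c ∈ A, f (x + c) = f x}
  add_mem' := by
    rintro f g ⟨h1, h2⟩ ⟨h3, h4⟩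
    exact ⟨fun x hx => by simp [h1 x hx, h3 x hx], fun x c hc => by simp [h2 x c hc, h4 x c hc]⟩
  zero_mem' := ⟨fun _ _ => rfl, fun _ _ _ => rfl⟩
  smul_mem' := by
    rintro t f ⟨h1, h2⟩
    exact ⟨fun x hx => by simp [h1 x hx], fun x c hc => by simp [h2 x c hc]⟩

/-- The CSS code is the space of functions on the quotient `B / A`. -/
def cssEquiv (n : ℕ) (A B : Submodule (GaloisField 2 2) (Word 2 2 n)) (hAB : A ≤ B) :
    cssCode n A B ≃ₗ[ℂ] ((B ⧸ A.comap B.subtype) → ℂ) where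
  toFun f := fun q => f.1 (Quotient.out q).1
  map_add' f g := rfl
  map_smul' c f := rfl
  invFun g := ⟨fun x => if h : x ∈ B then g (Submodule.Quotient.mk ⟨x, h⟩) else 0,
    fun x hx => by simp [hx], fun x c hc => by
      have hc' := hAB hc
      by_cases hx : x ∈ B
      · have hxc := B.add_mem hx hc'
        simp only [hx, hxc, dif_pos]
        congr 1
        rw [Submodule.Quotient.eq]
        simpa using hc
      · have hxc : x + c ∉ B := fun h => hx (by simpa using B.sub_mem h hc')
        simp only [hx, hxc, dif_neg, not_false_eq_true]⟩
  left_inv f := by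
    apply Subtype.ext
    funext x
    by_cases hx : x ∈ B
    · simp only [hx, dif_pos]
      have h : (Submodule.Quotient.mk (Quotient.out
          (Submodule.Quotient.mk ⟨x, hx⟩ : B ⧸ A.comap B.subtype)) : B ⧸ A.comap B.subtype)
          = Submodule.Quotient.mk ⟨x, hx⟩ := Quotient.out_eq _
      rw [Submodule.Quotient.eq] at h
      have h2 := f.2.2 x _ h
      rw [← h2]
      simp
    · simp only [hx, dif_neg, not_false_eq_true]
      exact (f.2.1 x hx).symm
  right_inv g := by
    funext q
    simp only [SetLike.coe_mem, dif_pos]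
    congr 1
    exact Quotient.out_eq _

lemma finrank_css (n : ℕ) (A B : Submodule (GaloisField 2 2) (Word 2 2 n)) (hAB : A ≤ B) :
    Module.finrank ℂ (cssCode n A B) = 4 ^ (Module.finrank (GaloisField 2 2) B
      - Module.finrank (GaloisField 2 2) A) := by
  rw [(cssEquiv n A B hAB).finrank_eq, Module.finrank_fintype_fun_eq_card,
    Module.card_eq_pow_finrank (K := GaloisField 2 2), gf_card, Submodule.finrank_quotient,
    (Submodule.comapSubtypeEquivOfLe hAB).finrank_eq]

lemma eta_two : eta 2 = -1 := by
  unfold eta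
  rw [← Complex.exp_pi_mul_I]
  congr 1
  push_cast
  ring

lemma chi_add (x y : ZMod 2) : chi 2 (x + y) = chi 2 x * chi 2 y := by
  unfold chi
  rw [eta_two]
  have h : ∀ x : ZMod 2, x = 0 ∨ x = 1 := by decide
  have h2 : (1 + 1 : ZMod 2) = 0 := by decide
  have h3 : (1 : ZMod 2).val = 1 := by decide
  rcases h x with rfl | rfl <;> rcases h y with rfl | rfl <;> simp [h2, h3]

lemma chi_ne_one (x : ZMod 2) (hx : x ≠ 0) : chi 2 x ≠ 1 := by
  unfold chi
  rw [eta_two]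
  have h : ∀ x : ZMod 2, x ≠ 0 → x = 1 := by decide
  have h3 : (1 : ZMod 2).val = 1 := by decide
  rw [h x hx, h3]
  norm_num

lemma wt_zero_iff {n : ℕ} {α : Type*} [Zero α] (u : Fin n → α) : wt u = 0 ↔ u = 0 := by
  unfold wt
  rw [Finset.card_eq_zero, Finset.filter_eq_empty_iff, funext_iff]
  simp

lemma not_mem_of_wt {n : ℕ} {α : Type*} [Zero α] (S : Set (Fin n → α)) (a : Fin n → α)
    (ha : a ≠ 0) (hw : wt a ≤ minDistS S - 1) : a ∉ S := by
  intro hS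
  have h : minDistS S ≤ wt a := Nat.sInf_le ⟨a, hS, ha, rfl⟩
  have : wt a ≠ 0 := fun h => ha ((wt_zero_iff a).1 h)
  omega

lemma css_X (n : ℕ) (A B : Submodule (GaloisField 2 2) (Word 2 2 n))
    (u v : QV 2 2 n) (hu : u ∈ cssCode n A B) (hv : v ∈ cssCode n A B)
    (a b : Word 2 2 n) (ha : a ∉ B) : hInner 2 2 n u (errOp 2 2 n a b v) = 0 := by
  apply Finset.sum_eq_zero
  intro x _
  by_cases hx : x ∈ B
  · have : x - a ∉ B := fun h => ha (by simpa using B.sub_mem hx h)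
    simp [errOp, hv.1 _ this]
  · simp [hu.1 _ hx]

lemma dotW_add (n : ℕ) (b x y : Word 2 2 n) :
    dotW 2 2 n b (x + y) = dotW 2 2 n b x + dotW 2 2 n b y := by
  simp [dotW, mul_add, Finset.sum_add_distrib]

lemma css_Z (n : ℕ) (A B : Submodule (GaloisField 2 2) (Word 2 2 n))
    (u v : QV 2 2 n) (hu : u ∈ cssCode n A B) (hv : v ∈ cssCode n A B)
    (b c : Word 2 2 n) (hc : c ∈ A) (hbc : dotW 2 2 n b c ≠ 0) :
    hInner 2 2 n u (errOp 2 2 n 0 b v) = 0 := by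
  obtain ⟨t, ht⟩ : ∃ t, gfTr 2 2 (t * dotW 2 2 n b c) ≠ 0 := by
    by_contra! h
    apply hbc
    refine (traceForm_nondegenerate (ZMod 2) (GaloisField 2 2)).1 _ fun t => ?_
    rw [Algebra.traceForm_apply, mul_comm]
    exact h t
  have htc : dotW 2 2 n b (t • c) = t * dotW 2 2 n b c := by
    simp only [dotW, Finset.mul_sum, Pi.smul_apply, smul_eq_mul]
    exact Finset.sum_congr rfl fun i _ => by ring
  have hA := A.smul_mem t hc
  have hS : hInner 2 2 n u (errOp 2 2 n 0 b v)
      = hInner 2 2 n u (errOp 2 2 n 0 b v) * chi 2 (gfTr 2 2 (t * dotW 2 2 n b c)) := by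
    conv_lhs => unfold hInner
    rw [← Equiv.sum_comp (Equiv.addRight (t • c))]
    unfold hInner
    rw [Finset.sum_mul]
    refine Finset.sum_congr rfl fun x _ => ?_
    simp only [errOp, LinearMap.coe_mk, AddHom.coe_mk, Equiv.coe_addRight, sub_zero]
    rw [hu.2 x _ hA, hv.2 x _ hA, dotW_add, htc]
    have : gfTr 2 2 (dotW 2 2 n b x + t * dotW 2 2 n b c)
      = gfTr 2 2 (dotW 2 2 n b x) + gfTr 2 2 (t * dotW 2 2 n b c) := map_add _ _ _
    rw [this, chi_add]
    ring
  by_contra hne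
  exact chi_ne_one _ ht (mul_left_cancel₀ hne (by rw [← hS, mul_one]))

/-- Theorem 6.1: a Hermitian self-orthogonal `[n,k]_4` linear code
`C` gives an asymmetric quantum code `((n, 4^{n-2k}, d'/d'))_4` with `d' = d(C^⊥H)`. -/
theorem statement10 (n k d' : ℕ) (hn : 0 < n)
    (C : Submodule (GaloisField 2 2) (Word 2 2 n))
    (hk : Module.finrank (GaloisField 2 2) C = k)
    (hso : C ≤ dualH n C)
    (hd' : minDistS ((dualH n C : Submodule (GaloisField 2 2) (Word 2 2 n)) :
        Set (Word 2 2 n)) = d') :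
    ∃ Q : Submodule ℂ (QV 2 2 n), IsAQEC 2 2 n Q (4 ^ (n - 2 * k)) d' d' := by
  subst hd' hk
  have hfd := finrank_dualH n C
  have hX : ∀ a : Word 2 2 n, a ≠ 0 → wt a ≤ minDistS (dualH n C : Set (Word 2 2 n)) - 1 →
      a ∉ dualH n C := fun a ha hw => not_mem_of_wt _ a ha hw
  refine ⟨cssCode n C (dualH n C), ?_, Nat.pos_of_ne_zero (by simp), ?_, ?_⟩
  · rw [finrank_css _ _ _ hso, hfd, Nat.sub_sub, two_mul]
  · intro u hu v hv huv a b ha hb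
    by_cases ha0 : a = 0
    · subst ha0
      by_cases hb0 : b = 0
      · subst hb0
        rw [← huv]
        congr 1
        funext x
        simp [errOp, dotW, gfTr, chi]
      · let b2 : Word 2 2 n := fun i => b i ^ 2
        have hw : wt b2 = wt b := by
          unfold wt
          congr 1
          ext i
          simp [b2]
        have hb2 : b2 ≠ 0 := fun h => hb0 ((wt_zero_iff b).1 (hw ▸ (wt_zero_iff b2).2 h))
        have hn2 := hX b2 hb2 (hw ▸ hb)
        obtain ⟨c, hc, hbc⟩ : ∃ c ∈ C, dotW 2 2 n b c ≠ 0 := by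
          by_contra! h
          apply hn2
          intro v hv
          have := congrArg (· ^ 2) (h v hv)
          simpa [dotW, gf_sum_sq, mul_pow] using this
        exact css_Z n C (dualH n C) u v hu hv b c hc hbc
    · exact css_X n _ _ u v hu hv a b (hX a ha0 ha)
  · intro _ u hu v hv a b ha1 ha _ _
    refine css_X n _ _ u v hu hv a b (hX a ?_ ha)
    intro h
    rw [(wt_zero_iff a).2 h] at ha1
    omega
end AQC
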